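/- Let G be a transitive digraph and f a discrete Morse function on G. Then for every critical allowed elementary n-path α on G, Φ(α) = α + V∂(α) and Φ(α + V∂(α)) = α + V∂(α); in particular α + V∂(α) ∈ P_n^Φ(G), where V = grad f and Φ = Id + ∂V + V∂. -/

import Mathlib

open scoped BigOperators Classical

namespace PathMorse

/-- A digraph: an irreflexive edge relation on a vertex set. -/
structure Digraph (V : Type) where
  E : V → V → Prop
  irrefl : ∀ v, ¬ E v v

/-- A digraph is transitive if `u→v` and `v→w` imply `u→w`. -/
def Digraph.Transitive {V : Type} (G : Digraph V) : Prop :=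
  ∀ u v w, G.E u v → G.E v w → G.E u w

/-- `Gbar` is the transitive closure of `G`: the smallest transitive digraph containing `G`. -/
def IsTransClosure {V : Type} (G Gbar : Digraph V) : Prop :=
  Gbar.Transitive ∧ (∀ u v, G.E u v → Gbar.E u v) ∧
    ∀ H : Digraph V, H.Transitive → (∀ u v, G.E u v → H.E u v) →
      ∀ u v, Gbar.E u v → H.E u v

/-- An elementary `n`-path on `V`: a sequence of `n+1` vertices. -/
abbrev Path (V : Type) (n : ℕ) := Fin (n+1) → V

/-- An elementary path is allowed on `G` if consecutive vertices are joined by directed edges. -/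
def Allowed {V : Type} (G : Digraph V) {n : ℕ} (p : Path V n) : Prop :=
  ∀ i : Fin n, G.E (p i.castSucc) (p i.succ)

/-- The `i`-th face of a path: delete the `i`-th vertex. -/
def face {V : Type} {n : ℕ} (i : Fin (n+2)) (p : Path V (n+1)) : Path V n :=
  p ∘ i.succAbove

/-- `q` is obtained from `p` by deleting one vertex (the codimension-one relation `q < p`). -/
def IsFace {V : Type} {n : ℕ} (q : Path V n) (p : Path V (n+1)) : Prop :=
  ∃ i : Fin (n+2), face i p = q

/-- Value of `f` on a path: sum of the values at the vertices. -/
def fPath {V : Type} (f : V → ℝ) {n : ℕ} (p : Path V n) : ℝ :=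
  ∑ i, f (p i)

/-- There is an allowed coface `γ > p` with `f γ = f p`. -/
def HasEqualCoface {V : Type} (G : Digraph V) (f : V → ℝ) {n : ℕ} (p : Path V n) : Prop :=
  ∃ γ : Path V (n+1), Allowed G γ ∧ IsFace p γ ∧ fPath f γ = fPath f p

/-- There is an allowed face `β < p` with `f β = f p`. -/
def HasEqualFace {V : Type} (G : Digraph V) (f : V → ℝ) : (n : ℕ) → Path V n → Prop
  | 0, _ => False
  | (n+1), p => ∃ β : Path V n, Allowed G β ∧ IsFace β p ∧ fPath f β = fPath f p

/-- A discrete Morse function on a digraph: nonnegative, and for each allowed elementary path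
there is at most one allowed coface with the same value, and at most one allowed face with the
same value. -/
def IsMorse {V : Type} (G : Digraph V) (f : V → ℝ) : Prop :=
  (∀ v, 0 ≤ f v) ∧
  (∀ n (α : Path V n), Allowed G α →
    ∀ γ₁ γ₂ : Path V (n+1), Allowed G γ₁ → Allowed G γ₂ → IsFace α γ₁ → IsFace α γ₂ →
      fPath f γ₁ = fPath f α → fPath f γ₂ = fPath f α → γ₁ = γ₂) ∧
  (∀ n (α : Path V (n+1)), Allowed G α →
    ∀ β₁ β₂ : Path V n, Allowed G β₁ → Allowed G β₂ → IsFace β₁ α → IsFace β₂ α →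
      fPath f β₁ = fPath f α → fPath f β₂ = fPath f α → β₁ = β₂)

/-- A critical path: allowed, with no allowed coface of equal value, no allowed face of equal value. -/
def IsCritical {V : Type} (G : Digraph V) (f : V → ℝ) {n : ℕ} (p : Path V n) : Prop :=
  Allowed G p ∧ ¬ HasEqualCoface G f p ∧ ¬ HasEqualFace G f n p

/-- `n`-chains: the real vector space with (orthonormal) basis the elementary `n`-paths. -/
abbrev Chain (V : Type) (n : ℕ) := Path V n → ℝ

variable {V : Type} [Fintype V] [DecidableEq V]

/-- The basis chain corresponding to an elementary path. -/
def unitP {n : ℕ} (p : Path V n) : Chain V n := Pi.single p 1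

/-- The boundary operator on chains (as a bare function). -/
def boundaryFun {n : ℕ} (x : Chain V (n+1)) : Chain V n :=
  fun q => ∑ p : Path V (n+1), x p * ∑ i : Fin (n+2), ((-1:ℝ)^(i:ℕ)) * (if face i p = q then 1 else 0)

/-- The boundary operator `∂ = Σ (-1)^i d_i` as a linear map. -/
def boundary (V : Type) [Fintype V] [DecidableEq V] (n : ℕ) : Chain V (n+1) →ₗ[ℝ] Chain V n where
  toFun := boundaryFun
  map_add' x y := by
    funext q
    simp [boundaryFun, add_mul, Finset.sum_add_distrib]
  map_smul' c x := by
    funext q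
    simp [boundaryFun, Finset.mul_sum, mul_assoc]

/-- `P_n(G)`: the span of the allowed elementary `n`-paths. -/
def pSpan (G : Digraph V) (n : ℕ) : Submodule ℝ (Chain V n) :=
  Submodule.span ℝ {x : Chain V n | ∃ p : Path V n, Allowed G p ∧ x = unitP p}

/-- `Ω_n(G) = {x ∈ P_n(G) : ∂x ∈ P_{n-1}(G)}` (with `Ω_0 = P_0`). -/
def omega (G : Digraph V) : (n : ℕ) → Submodule ℝ (Chain V n)
  | 0 => pSpan G 0
  | (n+1) => pSpan G (n+1) ⊓ (pSpan G n).comap (boundary V n)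

/-- The discrete gradient vector field on a basis path: `V(α) = -⟨∂γ,α⟩ γ` if there is an
allowed coface `γ > α` with `f γ = f α`, and `0` otherwise. -/
noncomputable def gradFun (G : Digraph V) (f : V → ℝ) {n : ℕ} (α : Path V n) : Chain V (n+1) :=
  if h : Allowed G α ∧ ∃ γ : Path V (n+1), Allowed G γ ∧ IsFace α γ ∧ fPath f γ = fPath f α then
    (-(boundary V n (unitP h.2.choose) α)) • unitP h.2.choose
  else 0

/-- The discrete gradient vector field `V = grad f`, extended linearly to chains. -/
noncomputable def grad (G : Digraph V) (f : V → ℝ) (n : ℕ) : Chain V n →ₗ[ℝ] Chain V (n+1) where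
  toFun x := ∑ α : Path V n, x α • gradFun G f α
  map_add' x y := by simp [add_smul, Finset.sum_add_distrib]
  map_smul' c x := by simp [Finset.smul_sum, smul_smul]

/-- The composite `V∂` in degree `n` (zero in degree `0`). -/
noncomputable def vd (G : Digraph V) (f : V → ℝ) : (n : ℕ) → (Chain V n →ₗ[ℝ] Chain V n)
  | 0 => 0
  | (n+1) => (grad G f n).comp (boundary V n)

/-- The discrete gradient flow `Φ = Id + ∂V + V∂`. -/
noncomputable def flow (G : Digraph V) (f : V → ℝ) (n : ℕ) : Chain V n →ₗ[ℝ] Chain V n :=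
  LinearMap.id + (boundary V n).comp (grad G f n) + vd G f n

/-- `P_n^Φ(G) = {x ∈ P_n(G) : Φ x = x}`. -/
noncomputable def pPhi (G : Digraph V) (f : V → ℝ) (n : ℕ) : Submodule ℝ (Chain V n) :=
  pSpan G n ⊓ LinearMap.ker (flow G f n - LinearMap.id)

/-- The cycles of a chain complex of subspaces `C` with differentials `D`
(in degree `0`, everything is a cycle). -/
def cycles (C : ∀ n, Submodule ℝ (Chain V n)) (D : ∀ n, Chain V (n+1) →ₗ[ℝ] Chain V n) :
    (m : ℕ) → Submodule ℝ (Chain V m)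
  | 0 => C 0
  | (m+1) => C (m+1) ⊓ LinearMap.ker (D m)

/-- Homology of the chain complex `(C, D)`: cycles modulo boundaries coming from `C`. -/
abbrev Homology (C : ∀ n, Submodule ℝ (Chain V n)) (D : ∀ n, Chain V (n+1) →ₗ[ℝ] Chain V n)
    (m : ℕ) :=
  (cycles C D m) ⧸ (Submodule.comap (cycles C D m).subtype ((C (m+1)).map (D m)))

/-- The operator `e^{tf}` on chains. -/
noncomputable def expOp (f : V → ℝ) (t : ℝ) (n : ℕ) : Chain V n →ₗ[ℝ] Chain V n where
  toFun x := fun p => Real.exp (t * fPath f p) * x p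
  map_add' x y := by funext p; simp [mul_add]
  map_smul' c x := by funext p; simp; ring

/-- The deformed boundary `∂_t = e^{tf} ∂ e^{-tf}`. -/
noncomputable def dT (f : V → ℝ) (t : ℝ) (n : ℕ) : Chain V (n+1) →ₗ[ℝ] Chain V n :=
  (expOp f t n).comp ((boundary V n).comp (expOp f (-t) (n+1)))

/-- The span of the elementary `n`-paths that are critical in `Gbar` and allowed in `G`. -/
def critSpan (G Gbar : Digraph V) (f : V → ℝ) (n : ℕ) : Submodule ℝ (Chain V n) :=
  Submodule.span ℝ {x : Chain V n | ∃ α : Path V n, IsCritical Gbar f α ∧ Allowed G α ∧ x = unitP α}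

omit [Fintype V] [DecidableEq V] in
theorem Allowed.edge_of_lt {G : Digraph V} (hG : G.Transitive) {n : ℕ} {p : Path V n}
    (hp : Allowed G p) {i j : Fin (n+1)} (hij : i < j) : G.E (p i) (p j) := by
  have : IsTrans V G.E := ⟨hG⟩
  exact (Fin.liftFun_iff_succ G.E).2 hp hij

omit [Fintype V] [DecidableEq V] in
theorem Allowed.face {G : Digraph V} (hG : G.Transitive) {n : ℕ} {p : Path V (n+1)}
    (hp : Allowed G p) (i : Fin (n+2)) : Allowed G (face i p) := fun k =>
  hp.edge_of_lt hG (Fin.strictMono_succAbove i k.castSucc_lt_succ)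

omit [Fintype V] [DecidableEq V] in
theorem Allowed.face_ne_of_lt {G : Digraph V} {n : ℕ} {p : Path V (n+1)}
    (hp : Allowed G p) {i j : Fin (n+2)} (hij : i < j) : PathMorse.face i p ≠ PathMorse.face j p := by
  intro h
  have hlt : (i : ℕ) < n + 1 := lt_of_lt_of_le hij (Nat.le_of_lt_succ j.isLt)
  have hk := congrFun h ⟨i, hlt⟩
  have h₁ : i.succAbove ⟨i, hlt⟩ = Fin.succ ⟨i, hlt⟩ :=
    Fin.succAbove_of_le_castSucc _ _ le_rfl
  have h₂ : j.succAbove ⟨i, hlt⟩ = Fin.castSucc ⟨i, hlt⟩ :=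
    Fin.succAbove_of_castSucc_lt _ _ hij
  simp only [PathMorse.face, Function.comp_apply, h₁, h₂] at hk
  exact G.irrefl _ (hk ▸ hp ⟨i, hlt⟩)

omit [Fintype V] [DecidableEq V] in
theorem Allowed.face_injective {G : Digraph V} {n : ℕ} {p : Path V (n+1)}
    (hp : Allowed G p) : Function.Injective fun i => PathMorse.face i p := by
  intro i j h
  by_contra hij
  rcases lt_or_gt_of_ne hij with hij | hij
  · exact hp.face_ne_of_lt hij h
  · exact hp.face_ne_of_lt hij h.symm

omit [Fintype V] [DecidableEq V] in
theorem fPath_eq_add_face (f : V → ℝ) {n : ℕ} (p : Path V (n+1)) (i : Fin (n+2)) :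
    fPath f p = f (p i) + fPath f (face i p) :=
  Fin.sum_univ_succAbove _ i

omit [Fintype V] [DecidableEq V] in
theorem IsMorse.zero_unique {G : Digraph V} {f : V → ℝ} (hG : G.Transitive) (hf : IsMorse G f)
    {n : ℕ} {p : Path V (n+1)} (hp : Allowed G p) {i j : Fin (n+2)}
    (hi : f (p i) = 0) (hj : f (p j) = 0) : i = j :=
  hp.face_injective <| hf.2.2 n p hp _ _ (hp.face hG i) (hp.face hG j) ⟨i, rfl⟩ ⟨j, rfl⟩
    (by simp [fPath_eq_add_face f p i, hi]) (by simp [fPath_eq_add_face f p j, hj])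

theorem boundary_unitP {n : ℕ} (p : Path V (n+1)) :
    boundary V n (unitP p) = ∑ i : Fin (n+2), ((-1:ℝ)^(i:ℕ)) • unitP (face i p) := by
  funext q
  simp [boundary, boundaryFun, unitP, Pi.single_apply, Finset.sum_apply, eq_comm]

theorem grad_unitP (G : Digraph V) (f : V → ℝ) {n : ℕ} (p : Path V n) :
    grad G f n (unitP p) = gradFun G f p := by
  simp [grad, unitP, Pi.single_apply]

/-- The span of the allowed paths through a zero of `f`. -/
def zeroSpan (G : Digraph V) (f : V → ℝ) (n : ℕ) : Submodule ℝ (Chain V n) :=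
  Submodule.span ℝ {x | ∃ p : Path V n, Allowed G p ∧ (∃ i, f (p i) = 0) ∧ x = unitP p}

omit [Fintype V] in
theorem zeroSpan_le_pSpan (G : Digraph V) (f : V → ℝ) (n : ℕ) :
    zeroSpan G f n ≤ pSpan G n :=
  Submodule.span_mono fun _ ⟨p, hp, _, hx⟩ => ⟨p, hp, hx⟩

theorem grad_mem_zeroSpan (G : Digraph V) (f : V → ℝ) {n : ℕ} (x : Chain V n) :
    grad G f n x ∈ zeroSpan G f (n+1) := by
  refine Submodule.sum_mem _ fun p _ => Submodule.smul_mem _ _ ?_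
  unfold gradFun
  split_ifs with h
  · obtain ⟨hγ, ⟨i, hi⟩, hfγ⟩ := h.2.choose_spec
    refine Submodule.smul_mem _ _ (Submodule.subset_span ⟨_, hγ, ⟨i, ?_⟩, rfl⟩)
    have := fPath_eq_add_face f h.2.choose i
    rw [hi, hfγ] at this
    linarith
  · exact Submodule.zero_mem _

theorem gradFun_eq_zero_of_zero {G : Digraph V} {f : V → ℝ} (hG : G.Transitive)
    (hf : IsMorse G f) {n : ℕ} {p : Path V n} {j : Fin (n+1)} (hj : f (p j) = 0) :
    gradFun G f p = 0 := by
  refine dif_neg ?_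
  rintro ⟨-, γ, hγ, ⟨i, rfl⟩, hfγ⟩
  have hi : f (γ i) = 0 := by
    have := fPath_eq_add_face f γ i
    linarith
  exact Fin.succAbove_ne i j (hf.zero_unique hG hγ hj hi)

theorem gradFun_face_of_zero {G : Digraph V} {f : V → ℝ} (hG : G.Transitive)
    (hf : IsMorse G f) {n : ℕ} {p : Path V (n+1)} (hp : Allowed G p) {i : Fin (n+2)}
    (hi : f (p i) = 0) : gradFun G f (face i p) = -((-1:ℝ)^(i:ℕ)) • unitP p := by
  have hfp : fPath f p = fPath f (face i p) := by simp [fPath_eq_add_face f p i, hi]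
  have h : Allowed G (face i p) ∧ ∃ γ : Path V (n+1), Allowed G γ ∧ IsFace (face i p) γ ∧
      fPath f γ = fPath f (face i p) := ⟨hp.face hG i, p, hp, ⟨i, rfl⟩, hfp⟩
  have hc : h.2.choose = p := by
    obtain ⟨h₁, h₂, h₃⟩ := h.2.choose_spec
    exact hf.2.1 n _ h.1 _ _ h₁ hp h₂ ⟨i, rfl⟩ h₃ hfp
  have hb : boundary V n (unitP p) (face i p) = (-1:ℝ)^(i:ℕ) := by
    rw [boundary_unitP]
    simp [unitP, Pi.single_apply, hp.face_injective.eq_iff]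
  rw [gradFun, dif_pos h, hc, hb]

theorem grad_eq_zero_of_mem_zeroSpan {G : Digraph V} {f : V → ℝ} (hG : G.Transitive)
    (hf : IsMorse G f) {n : ℕ} {x : Chain V n} (hx : x ∈ zeroSpan G f n) :
    grad G f n x = 0 := by
  have hle : zeroSpan G f n ≤ LinearMap.ker (grad G f n) := by
    refine Submodule.span_le.2 ?_
    rintro _ ⟨p, -, ⟨j, hj⟩, rfl⟩
    exact (grad_unitP G f p).trans (gradFun_eq_zero_of_zero hG hf hj)
  exact hle hx

theorem grad_boundary_of_mem_zeroSpan {G : Digraph V} {f : V → ℝ} (hG : G.Transitive)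
    (hf : IsMorse G f) {n : ℕ} {x : Chain V (n+1)} (hx : x ∈ zeroSpan G f (n+1)) :
    grad G f n (boundary V n x) = -x := by
  induction hx using Submodule.span_induction with
  | zero => simp
  | add x y _ _ hx hy => rw [map_add, map_add, hx, hy, neg_add]
  | smul c x _ hx => rw [map_smul, map_smul, hx, smul_neg]
  | mem x hx =>
    obtain ⟨p, hp, ⟨i, hi⟩, rfl⟩ := hx
    rw [boundary_unitP, map_sum, Finset.sum_eq_single i]
    · rw [map_smul, grad_unitP, gradFun_face_of_zero hG hf hp hi, smul_smul, mul_neg,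
        ← mul_pow]
      simp
    · intro k _ hk
      obtain ⟨j, hj⟩ := Fin.exists_succAbove_eq hk.symm
      rw [map_smul, grad_unitP, gradFun_eq_zero_of_zero hG hf (j := j), smul_zero]
      simpa [face, hj] using hi
    · simp

theorem vd_mem_zeroSpan (G : Digraph V) (f : V → ℝ) (n : ℕ) (x : Chain V n) :
    vd G f n x ∈ zeroSpan G f n := by
  cases n with
  | zero => exact Submodule.zero_mem _
  | succ n => exact grad_mem_zeroSpan G f _

theorem flow_vd {G : Digraph V} {f : V → ℝ} (hG : G.Transitive) (hf : IsMorse G f) (n : ℕ)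
    (x : Chain V n) : flow G f n (vd G f n x) = 0 := by
  have hx := vd_mem_zeroSpan G f n x
  have hgrad := grad_eq_zero_of_mem_zeroSpan hG hf hx
  cases n with
  | zero => simp [vd]
  | succ n =>
    have hvd : vd G f (n+1) (vd G f (n+1) x) = -vd G f (n+1) x :=
      grad_boundary_of_mem_zeroSpan hG hf hx
    simp [flow, hgrad, hvd]

theorem IsCritical.flow_unitP {G : Digraph V} {f : V → ℝ} {n : ℕ} {p : Path V n}
    (hp : IsCritical G f p) : flow G f n (unitP p) = unitP p + vd G f n (unitP p) := by
  have hgrad : grad G f n (unitP p) = 0 :=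
    (grad_unitP G f p).trans (dif_neg fun h => hp.2.1 h.2)
  simp [flow, hgrad]

/-- On a transitive digraph, for every critical path `α`, `Φ(α) = α + V∂α` and
`Φ(α + V∂α) = α + V∂α`; in particular `α + V∂α ∈ P_n^Φ(G)`. -/
theorem stmt10 {V : Type} [Fintype V] [DecidableEq V] (G : Digraph V) (f : V → ℝ)
    (hG : G.Transitive) (hf : IsMorse G f) (n : ℕ) (α : Path V n)
    (hα : IsCritical G f α) :
    flow G f n (unitP α) = unitP α + vd G f n (unitP α) ∧
    flow G f n (unitP α + vd G f n (unitP α)) = unitP α + vd G f n (unitP α) ∧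
    unitP α + vd G f n (unitP α) ∈ pPhi G f n := by
  have hfix : flow G f n (unitP α + vd G f n (unitP α)) = unitP α + vd G f n (unitP α) := by
    rw [map_add, hα.flow_unitP, flow_vd hG hf, add_zero]
  refine ⟨hα.flow_unitP, hfix, Submodule.add_mem _ ?_ ?_, ?_⟩
  · exact Submodule.subset_span ⟨α, hα.1, rfl⟩
  · exact zeroSpan_le_pSpan G f n (vd_mem_zeroSpan G f n _)
  · simp [hfix]

end PathMorse
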